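/- For every finite connected simple port-labeled graph G with n vertices, every root vertex v_R, and every integer k with 2 ≤ k ≤ n: if v_i (with i < s) is a rootpath vertex other than v_L, then during the k-stopped port-DFS traversal the walk leaves v_i via its child port port(v_i, v_{i+1}) exactly once. -/

import Mathlib

open scoped Classical

/-- Direction of a move of the port-DFS traversal. -/
inductive PDir : Type where
  | fwd : PDir
  | bwd : PDir
deriving DecidableEq

/-- Position of the port-DFS walk: before the first move (`start`, at the root),
having just arrived at `cur` via in-port `inPort` with direction `dir` (`moving`),
or halted at a vertex. -/
inductive PPos (V : Type) : Type where
  | start : PPos V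
  | moving : V → ℕ → PDir → PPos V
  | halted : V → PPos V

/-- Full state of the port-DFS traversal: position, set `S` of visited vertices,
and parent-port assignment `par`. -/
structure PState (V : Type) : Type where
  pos : PPos V
  vis : Finset V
  par : V → ℕ

/-- A finite connected simple port-labeled graph: for every vertex `u` of degree
`deg u`, the edges incident to `u` are labeled by distinct ports `0, …, deg u - 1`;
`port u v` is the port at `u` of the edge `{u, v}`. -/
structure PortedGraph (V : Type) [Fintype V] [DecidableEq V] : Type where
  G : SimpleGraph V
  conn : G.Connected
  deg : V → ℕ
  port : V → V → ℕ
  port_lt : ∀ {u v : V}, G.Adj u v → port u v < deg u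
  port_inj : ∀ {u v w : V}, G.Adj u v → G.Adj u w → port u v = port u w → v = w
  port_surj : ∀ {u : V} (p : ℕ), p < deg u → ∃ v : V, G.Adj u v ∧ port u v = p

namespace PortedGraph

variable {V : Type} [Fintype V] [DecidableEq V]

/-- The neighbor of `u` reached from `u` through port `p`. -/
noncomputable def dest (P : PortedGraph V) (u : V) (p : ℕ) : V :=
  if h : ∃ v : V, P.G.Adj u v ∧ P.port u v = p then h.choose else u

/-- One step of the port-DFS traversal from root `vR`.  A state with
`pos = moving v q d` means the walk has just arrived at `v` via port `q` (at `v`)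
with direction `d`, and `vis`/`par` are the data from before processing this
arrival; the step processes the arrival according to rules (i)–(v) and performs
the next move (or halts). -/
noncomputable def step (P : PortedGraph V) (vR : V) (s : PState V) : PState V :=
  match s.pos with
  | PPos.start =>
      if 0 < P.deg vR then
        { pos := PPos.moving (P.dest vR 0) (P.port (P.dest vR 0) vR) PDir.fwd,
          vis := s.vis, par := s.par }
      else
        { pos := PPos.halted vR, vis := s.vis, par := s.par }
  | PPos.halted v => { pos := PPos.halted v, vis := s.vis, par := s.par }
  | PPos.moving v q PDir.fwd =>
      if v ∈ s.vis then
        -- rule (ii): leave via `q` with direction backward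
        { pos := PPos.moving (P.dest v q) (P.port (P.dest v q) v) PDir.bwd,
          vis := s.vis, par := s.par }
      else
        -- rule (i): add `v` to `S`, set `par v := q`, leave via `(q+1) % deg v`
        { pos := PPos.moving (P.dest v ((q + 1) % P.deg v))
            (P.port (P.dest v ((q + 1) % P.deg v)) v)
            (if (q + 1) % P.deg v = q then PDir.bwd else PDir.fwd),
          vis := insert v s.vis, par := Function.update s.par v q }
  | PPos.moving v q PDir.bwd =>
      if v ≠ vR ∧ (q + 1) % P.deg v = s.par v then
        -- rule (iii): leave via the parent port with direction backward
        { pos := PPos.moving (P.dest v (s.par v)) (P.port (P.dest v (s.par v)) v) PDir.bwd,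
          vis := s.vis, par := s.par }
      else if v = vR ∧ (q + 1) % P.deg v = 0 then
        -- rule (iv): halt
        { pos := PPos.halted v, vis := s.vis, par := s.par }
      else
        -- rule (v): leave via `(q+1) % deg v` with direction forward
        { pos := PPos.moving (P.dest v ((q + 1) % P.deg v))
            (P.port (P.dest v ((q + 1) % P.deg v)) v) PDir.fwd,
          vis := s.vis, par := s.par }

/-- The trace of the port-DFS traversal from `vR`:  `trace P vR t` is the state
after `t` transitions; every transition except those into/out of a halted
position is a move along an edge. -/
noncomputable def trace (P : PortedGraph V) (vR : V) : ℕ → PState V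
  | 0 => { pos := PPos.start, vis := {vR}, par := fun _ => 0 }
  | t + 1 => P.step vR (P.trace vR t)

/-- The first time at which `k` distinct vertices have been visited; the
`k`-stopped traversal is the traversal halted at that moment (at which point the
walk, having made `stopTime - 1` moves, stands at the `k`-th visited vertex). -/
noncomputable def stopTime (P : PortedGraph V) (vR : V) (k : ℕ) : ℕ :=
  sInf {t : ℕ | k ≤ ((P.trace vR t).vis).card}

/-- `V'`: the set of vertices visited by the `k`-stopped traversal. -/
noncomputable def visitedBy (P : PortedGraph V) (vR : V) (k : ℕ) : Finset V :=
  (P.trace vR (P.stopTime vR k)).vis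

/-- `V'` as a set. -/
noncomputable def Vset (P : PortedGraph V) (vR : V) (k : ℕ) : Set V :=
  ↑(P.visitedBy vR k)

/-- The parent-port assignment at the end of the `k`-stopped traversal. -/
noncomputable def parFinal (P : PortedGraph V) (vR : V) (k : ℕ) : V → ℕ :=
  (P.trace vR (P.stopTime vR k)).par

/-- `u(v)`: the neighbor of `v` reached from `v` through its parent port. -/
noncomputable def parentVert (P : PortedGraph V) (vR : V) (k : ℕ) (v : V) : V :=
  P.dest v (P.parFinal vR k v)

/-- `v_L`: the `k`-th (last) vertex added to `S` by the `k`-stopped traversal. -/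
noncomputable def lastVert (P : PortedGraph V) (vR : V) (k : ℕ) : V :=
  if h : ∃ v : V, v ∈ P.visitedBy vR k ∧ v ∉ (P.trace vR (P.stopTime vR k - 1)).vis
  then h.choose else vR

/-- The tree `T` of parent edges `{v, u(v)}`, `v ∈ V' \ {v_R}`, as a graph on `V`
(vertices outside `V'` are isolated). -/
noncomputable def treeRel (P : PortedGraph V) (vR : V) (k : ℕ) : SimpleGraph V :=
  SimpleGraph.fromRel (fun a b =>
    a ∈ P.visitedBy vR k ∧ a ≠ vR ∧ b = P.parentVert vR k a)

/-- The tree `T` of parent edges as a graph on the vertex set `V'`. -/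
noncomputable def treeSub (P : PortedGraph V) (vR : V) (k : ℕ) :
    SimpleGraph (P.Vset vR k) :=
  SimpleGraph.fromRel (fun a b => (a : V) ≠ vR ∧ (b : V) = P.parentVert vR k (a : V))

/-- `v` lies on the rootpath: the unique path in `T` from `v_R` to `v_L`. -/
def onRootpath (P : PortedGraph V) (vR : V) (k : ℕ) (v : V) : Prop :=
  ∃ p : (P.treeRel vR k).Walk vR (P.lastVert vR k), p.IsPath ∧ v ∈ p.support

/-- The move made out of state `s`:  `some (v, p, d)` if the walk leaves vertex
`v` via port `p` with direction `d`, and `none` if it halts (or already halted). -/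
noncomputable def exitEvent (P : PortedGraph V) (vR : V) (s : PState V) :
    Option (V × ℕ × PDir) :=
  match s.pos with
  | PPos.start => if 0 < P.deg vR then some (vR, 0, PDir.fwd) else none
  | PPos.halted _ => none
  | PPos.moving v q PDir.fwd =>
      if v ∈ s.vis then some (v, q, PDir.bwd)
      else some (v, (q + 1) % P.deg v,
        if (q + 1) % P.deg v = q then PDir.bwd else PDir.fwd)
  | PPos.moving v q PDir.bwd =>
      if v ≠ vR ∧ (q + 1) % P.deg v = s.par v then some (v, s.par v, PDir.bwd)
      else if v = vR ∧ (q + 1) % P.deg v = 0 then none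
      else some (v, (q + 1) % P.deg v, PDir.fwd)

end PortedGraph

/-! ### Paths to the root of a parent-pointer graph -/

/-- In a graph all of whose edges join a vertex `a ≠ r` to `f a`, a path ending at `r` passes
through the parent of its first vertex. -/
theorem SimpleGraph.Walk.IsPath.parent_mem_support {V : Type*} {G : SimpleGraph V} {f : V → V}
    {r : V} (hG : ∀ a b, G.Adj a b → (a ≠ r ∧ b = f a) ∨ (b ≠ r ∧ a = f b)) {x : V}
    (p : G.Walk x r) (hp : p.IsPath) (hx : x ≠ r) : f x ∈ p.support := by
  induction p with
  | nil => exact absurd rfl hx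
  | cons h p ih =>
    rw [SimpleGraph.Walk.cons_isPath_iff] at hp
    rcases hG _ _ h with ⟨_, h2⟩ | ⟨h1, h2⟩
    · rw [← h2]; simp
    · exact absurd (h2 ▸ ih hG hp.1 h1) hp.2

/-- In a graph all of whose edges join a vertex `a ≠ r` to `f a`, a path ending at `r` stays in
every parent-closed set that contains its first vertex. -/
theorem SimpleGraph.Walk.IsPath.support_subset_of_parent_closed {V : Type*} {G : SimpleGraph V}
    {f : V → V} {r : V}
    (hG : ∀ a b, G.Adj a b → (a ≠ r ∧ b = f a) ∨ (b ≠ r ∧ a = f b)) {A : Set V}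
    (hA : ∀ a ∈ A, a ≠ r → f a ∈ A) {x : V} (p : G.Walk x r) (hp : p.IsPath) (hx : x ∈ A) :
    ∀ y ∈ p.support, y ∈ A := by
  induction p with
  | nil => simpa using hx
  | cons h p ih =>
    rw [SimpleGraph.Walk.cons_isPath_iff] at hp
    rcases hG _ _ h with ⟨h1, h2⟩ | ⟨h1, h2⟩
    · have hy := hA _ hx h1
      rw [← h2] at hy
      intro y hyp
      rw [SimpleGraph.Walk.support_cons, List.mem_cons] at hyp
      rcases hyp with rfl | hyp
      · exact hx
      · exact ih hG hA hp.1 hy y hyp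
    · exact absurd (h2 ▸ SimpleGraph.Walk.IsPath.parent_mem_support hG p hp.1 h1) hp.2

namespace PortedGraph

section Traversal

variable {V : Type} [Fintype V] [DecidableEq V] (P : PortedGraph V)

theorem dest_spec {u : V} {p : ℕ} (h : p < P.deg u) :
    P.G.Adj u (P.dest u p) ∧ P.port u (P.dest u p) = p := by
  have h' := P.port_surj p h
  unfold dest
  rw [dif_pos h']
  exact h'.choose_spec

theorem dest_port {u v : V} (h : P.G.Adj u v) : P.dest u (P.port u v) = v := by
  obtain ⟨h1, h2⟩ := P.dest_spec (P.port_lt h)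
  exact P.port_inj h1 h h2

theorem dest_port_dest {u : V} {p : ℕ} (h : p < P.deg u) :
    P.dest (P.dest u p) (P.port (P.dest u p) u) = u :=
  P.dest_port (P.dest_spec h).1.symm

theorem port_dest_lt {u : V} {p : ℕ} (h : p < P.deg u) :
    P.port (P.dest u p) u < P.deg (P.dest u p) :=
  P.port_lt (P.dest_spec h).1.symm

theorem step_pos_of_exitEvent {vR : V} {s : PState V} {u : V} {p : ℕ} {d : PDir}
    (h : P.exitEvent vR s = some (u, p, d)) :
    (P.step vR s).pos = PPos.moving (P.dest u p) (P.port (P.dest u p) u) d := by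
  obtain ⟨pos, vis, par⟩ := s
  rcases pos with _ | ⟨x, q, _ | _⟩ | x <;> simp only [exitEvent, step] at h ⊢ <;>
    grind

theorem exists_exitEvent_of_step_pos {vR : V} {s : PState V} {x : V} {q : ℕ} {d : PDir}
    (hs : ∀ y r e, s.pos ≠ PPos.moving y r e ∨ r < P.deg y)
    (h : (P.step vR s).pos = PPos.moving x q d) :
    P.exitEvent vR s = some (P.dest x q, P.port (P.dest x q) x, d) := by
  have key : ∀ u p, p < P.deg u →
      PPos.moving (P.dest u p) (P.port (P.dest u p) u) d = PPos.moving x q d →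
      P.dest x q = u ∧ P.port (P.dest x q) x = p := by
    intro u p hp he
    injection he with h1 h2 h3
    subst h1 h2
    rw [P.dest_port_dest hp]
    exact ⟨rfl, (P.dest_spec hp).2⟩
  obtain ⟨pos, vis, par⟩ := s
  rcases pos with _ | ⟨y, r, _ | _⟩ | y <;> simp only [exitEvent, step] at h ⊢
  · split_ifs at h ⊢ with h0
    simp only [PPos.moving.injEq] at h
    grind
  · have hr : r < P.deg y := by simpa using hs y r PDir.fwd
    have hm : (r + 1) % P.deg y < P.deg y := Nat.mod_lt _ (by omega)
    grind
  · have hr : r < P.deg y := by simpa using hs y r PDir.bwd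
    have hm : (r + 1) % P.deg y < P.deg y := Nat.mod_lt _ (by omega)
    grind
  · cases h

/-- A step either leaves the visited set and the parent ports alone, or it adds the vertex
that has just been entered in forward direction. -/
theorem step_vis_par (vR : V) (s : PState V) :
    ((P.step vR s).vis = s.vis ∧ (P.step vR s).par = s.par) ∨
      ∃ x q, s.pos = PPos.moving x q PDir.fwd ∧ x ∉ s.vis ∧
        (P.step vR s).vis = insert x s.vis ∧
        (P.step vR s).par = Function.update s.par x q := by
  obtain ⟨pos, vis, par⟩ := s
  rcases pos with _ | ⟨y, r, _ | _⟩ | y <;> simp only [step] <;> grind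

theorem trace_vis_mono (vR : V) : Monotone fun t => (P.trace vR t).vis := by
  refine monotone_nat_of_le_succ fun t => ?_
  rcases P.step_vis_par vR (P.trace vR t) with ⟨h, _⟩ | ⟨x, q, _, _, h, _⟩
  · exact h.ge
  · exact (Finset.subset_insert _ _).trans h.ge

theorem trace_par_eq {vR x : V} {i j : ℕ} (hij : i ≤ j) (hx : x ∈ (P.trace vR i).vis) :
    (P.trace vR j).par x = (P.trace vR i).par x := by
  induction j, hij using Nat.le_induction with
  | base => rfl
  | succ j hij ih =>
    rw [← ih]
    have hxj := P.trace_vis_mono vR hij hx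
    rcases P.step_vis_par vR (P.trace vR j) with ⟨_, h⟩ | ⟨y, q, _, hy, _, h⟩
    · exact congrFun h x
    · refine (congrFun h x).trans (Function.update_of_ne ?_ _ _)
      rintro rfl
      exact hy hxj

/-- `l` lists a vertex, its parent, its grandparent, and so on up to the root `vR`. -/
def IsParentChain (vR : V) (par : V → ℕ) : List V → Prop
  | [] => False
  | [a] => a = vR
  | a :: b :: l => a ≠ vR ∧ b = P.dest a (par a) ∧ IsParentChain vR par (b :: l)

variable {P}

theorem IsParentChain.congr {vR : V} {par par' : V → ℕ} :
    ∀ {l : List V}, P.IsParentChain vR par l → (∀ a ∈ l, par' a = par a) →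
      P.IsParentChain vR par' l
  | [], h, _ => h
  | [_], h, _ => h
  | a :: b :: l, ⟨h1, h2, h3⟩, h =>
    ⟨h1, by rw [h a (by simp)]; exact h2, h3.congr fun c hc => h c (by simp_all)⟩

theorem IsParentChain.dest_mem {vR : V} {par : V → ℕ} :
    ∀ {l : List V}, P.IsParentChain vR par l → ∀ a ∈ l, a ≠ vR → P.dest a (par a) ∈ l
  | [b], h, a, ha, hne => by
    rw [List.mem_singleton] at ha
    exact absurd (ha.trans h) hne
  | b :: c :: l, ⟨_, h2, h3⟩, a, ha, hne => by
    rcases List.mem_cons.1 ha with rfl | ha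
    · rw [← h2]; simp
    · exact List.mem_cons_of_mem _ (h3.dest_mem a ha hne)

theorem IsParentChain.dest_ne_head {vR v : V} {par : V → ℕ} :
    ∀ {l : List V}, P.IsParentChain vR par (v :: l) → (v :: l).Nodup →
      ∀ a ∈ v :: l, a ≠ vR → P.dest a (par a) ≠ v
  | [], h, _, a, ha, hne => by
    rw [List.mem_singleton] at ha
    exact absurd (ha.trans h) hne
  | c :: l, ⟨_, h2, h3⟩, hnd, a, ha, hne => by
    rintro rfl
    rw [List.nodup_cons] at hnd
    rcases List.mem_cons.1 ha with h | ha
    · rw [← h] at h2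
      exact hnd.1 (by rw [← h2]; simp)
    · exact hnd.1 (h3.dest_mem a ha hne)

variable (P)

/-- The update of the depth-first search stack performed by one step from state `s`. -/
noncomputable def nextStack (vR : V) (s : PState V) (l : List V) : List V :=
  match s.pos with
  | PPos.start => l
  | PPos.halted _ => l
  | PPos.moving v q PDir.fwd =>
      if v ∈ s.vis then l else if (q + 1) % P.deg v = q then l else v :: l
  | PPos.moving v q PDir.bwd =>
      if v ≠ vR ∧ (q + 1) % P.deg v = s.par v then l.tail else l

/-- The depth-first search stack after `t` transitions, top first. -/
noncomputable def stack (P : PortedGraph V) (vR : V) : ℕ → List V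
  | 0 => [vR]
  | t + 1 => P.nextStack vR (P.trace vR t) (P.stack vR t)

/-- What the position of the walk says about the stack `l`. -/
def PosInv (vR : V) (par : V → ℕ) (l : List V) : PPos V → Prop
  | PPos.start => l.head? = some vR
  | PPos.halted _ => True
  | PPos.moving x q PDir.fwd =>
      q < P.deg x ∧ l.head? = some (P.dest x q) ∧
        (P.dest x q ≠ vR → P.port (P.dest x q) x ≠ par (P.dest x q))
  | PPos.moving x q PDir.bwd => q < P.deg x ∧ l.head? = some x

/-- The invariant relating a state of the traversal to its stack. -/
structure StackInv (vR : V) (s : PState V) (l : List V) : Prop where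
  root_mem : vR ∈ s.vis
  nodup : l.Nodup
  subset : ∀ a ∈ l, a ∈ s.vis
  chain : P.IsParentChain vR s.par l
  pos : P.PosInv vR s.par l s.pos

variable {P}

theorem StackInv.step {vR : V} {s : PState V} {l : List V} (h : P.StackInv vR s l) :
    P.StackInv vR (P.step vR s) (P.nextStack vR s l) := by
  obtain ⟨pos, vis, par⟩ := s
  obtain ⟨hroot, hnd, hsub, hch, hpos⟩ := h
  rcases pos with _ | ⟨x, q, _ | _⟩ | x <;>
    simp only [PortedGraph.step, nextStack, PosInv] at *
  · split_ifs with h0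
    · refine ⟨hroot, hnd, hsub, hch, P.port_dest_lt h0, ?_, ?_⟩
      · rw [P.dest_port_dest h0, hpos]
      · rw [P.dest_port_dest h0]; exact fun h => absurd rfl h
    · exact ⟨hroot, hnd, hsub, hch, trivial⟩
  · obtain ⟨hq, hhead, hpar⟩ := hpos
    have hr : (q + 1) % P.deg x < P.deg x := Nat.mod_lt _ (by omega)
    by_cases hx : x ∈ vis
    · rw [if_pos hx, if_pos hx]
      exact ⟨hroot, hnd, hsub, hch, P.port_dest_lt hq, hhead⟩
    rw [if_neg hx, if_neg hx]
    have hxl : x ∉ l := fun h => hx (hsub x h)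
    have hch' : P.IsParentChain vR (Function.update par x q) l :=
      hch.congr fun a ha => Function.update_of_ne (by rintro rfl; exact hxl ha) _ _
    by_cases hrq : (q + 1) % P.deg x = q
    · rw [if_pos hrq, if_pos hrq]
      refine ⟨Finset.mem_insert_of_mem hroot, hnd,
        fun a ha => Finset.mem_insert_of_mem (hsub a ha), hch', P.port_dest_lt hr, ?_⟩
      rw [hrq, hhead]
    · rw [if_neg hrq, if_neg hrq]
      refine ⟨Finset.mem_insert_of_mem hroot, List.nodup_cons.2 ⟨hxl, hnd⟩, ?_, ?_,
        P.port_dest_lt hr, ?_, ?_⟩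
      · intro a ha
        rcases List.mem_cons.1 ha with rfl | ha
        · exact Finset.mem_insert_self _ _
        · exact Finset.mem_insert_of_mem (hsub a ha)
      · cases l with
        | nil => exact hch.elim
        | cons b l =>
          refine ⟨fun h => hx (h ▸ hroot), ?_, hch'⟩
          simpa using hhead
      · rw [P.dest_port_dest hr]; rfl
      · intro _
        rw [P.dest_port_dest hr, (P.dest_spec hr).2]
        simpa using hrq
  · obtain ⟨hq, hhead⟩ := hpos
    have hr : (q + 1) % P.deg x < P.deg x := Nat.mod_lt _ (by omega)
    by_cases h3 : x ≠ vR ∧ (q + 1) % P.deg x = par x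
    · rw [if_pos h3, if_pos h3]
      rw [h3.2] at hr
      match l, hhead, hch, hnd, hsub with
      | [b], hhead, hch, _, _ =>
        simp only [List.head?_cons, Option.some.injEq] at hhead
        exact absurd (hhead ▸ hch) h3.1
      | b :: c :: l, hhead, hch, hnd, hsub =>
        simp only [List.head?_cons, Option.some.injEq] at hhead
        subst hhead
        exact ⟨hroot, (List.nodup_cons.1 hnd).2,
          fun a ha => hsub a (List.mem_cons_of_mem _ ha), hch.2.2, P.port_dest_lt hr,
          congrArg some hch.2.1⟩
    · rw [if_neg h3, if_neg h3]
      split_ifs with h4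
      · exact ⟨hroot, hnd, hsub, hch, trivial⟩
      · refine ⟨hroot, hnd, hsub, hch, P.port_dest_lt hr, ?_, ?_⟩
        · rw [P.dest_port_dest hr, hhead]
        · rw [P.dest_port_dest hr, (P.dest_spec hr).2]
          exact fun h1 h2 => h3 ⟨h1, h2⟩
  · exact ⟨hroot, hnd, hsub, hch, trivial⟩

variable (P)

theorem stackInv_trace (vR : V) (t : ℕ) : P.StackInv vR (P.trace vR t) (P.stack vR t) := by
  induction t with
  | zero => exact ⟨by simp [trace], by simp [stack], by simp [stack, trace], rfl, rfl⟩
  | succ t ih => exact ih.step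

theorem mem_nextStack {vR x : V} {s : PState V} {l : List V} (hx : x ∈ s.vis)
    (h : x ∈ P.nextStack vR s l) : x ∈ l := by
  obtain ⟨pos, vis, par⟩ := s
  rcases pos with _ | ⟨y, r, _ | _⟩ | y <;> simp only [nextStack] at h
  · exact h
  · split_ifs at h with h1 h2
    · exact h
    · exact h
    · rcases List.mem_cons.1 h with rfl | h
      · exact absurd hx h1
      · exact h
  · split_ifs at h
    · exact List.mem_of_mem_tail h
    · exact h
  · exact h

/-- A visited vertex that has left the stack never returns to it. -/
theorem mem_stack_of_le {vR x : V} {i j : ℕ} (hij : i ≤ j) (hx : x ∈ (P.trace vR i).vis)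
    (h : x ∈ P.stack vR j) : x ∈ P.stack vR i := by
  induction j, hij using Nat.le_induction with
  | base => exact h
  | succ j hij ih => exact ih (P.mem_nextStack (P.trace_vis_mono vR hij hx) h)

theorem port_lt_of_pos_trace {vR y : V} {t r : ℕ} {e : PDir}
    (h : (P.trace vR t).pos = PPos.moving y r e) : r < P.deg y := by
  have hi := (P.stackInv_trace vR t).pos
  rw [h] at hi
  cases e <;> exact hi.1

theorem head?_stack_of_fwd {vR x : V} {t q : ℕ}
    (h : (P.trace vR t).pos = PPos.moving x q PDir.fwd) :
    (P.stack vR t).head? = some (P.dest x q) := by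
  have hi := (P.stackInv_trace vR t).pos
  rw [h] at hi
  exact hi.2.1

/-- While a vertex `w` is on the stack, its parent `v` is not left towards `w`. -/
theorem exitEvent_ne_of_mem_stack {vR v w : V} {t : ℕ} {d : PDir} (hwR : w ≠ vR)
    (hw : w ∈ P.stack vR t) (hlt : (P.trace vR t).par w < P.deg w)
    (hv : P.dest w ((P.trace vR t).par w) = v) :
    P.exitEvent vR (P.trace vR t) ≠ some (v, P.port v w, d) := by
  intro hex
  have hadj : P.G.Adj w v := hv ▸ (P.dest_spec hlt).1
  have hport : P.port w v = (P.trace vR t).par w := hv ▸ (P.dest_spec hlt).2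
  have hnothead : (P.stack vR t).head? ≠ some v := by
    intro hh
    have hinv := P.stackInv_trace vR t
    cases hl : P.stack vR t with
    | nil => simp [hl] at hh
    | cons b l =>
      rw [hl] at hh hinv hw
      simp only [List.head?_cons, Option.some.injEq] at hh
      subst hh
      exact hinv.chain.dest_ne_head hinv.nodup w hw hwR hv
  have hvvis : v ∈ (P.trace vR t).vis := by
    rw [← hv]
    exact (P.stackInv_trace vR t).subset _
      ((P.stackInv_trace vR t).chain.dest_mem w hw hwR)
  have hpos := (P.stackInv_trace vR t).pos
  unfold exitEvent at hex
  cases hc : (P.trace vR t).pos with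
  | start =>
    rw [hc] at hex hpos
    simp only [PosInv] at hex hpos
    split_ifs at hex
    simp only [Option.some.injEq, Prod.mk.injEq] at hex
    exact hnothead (hex.1 ▸ hpos)
  | halted x => simp [hc] at hex
  | moving x q e =>
    rw [hc] at hex hpos
    cases e with
    | fwd =>
      simp only [PosInv] at hex hpos
      split_ifs at hex with h1
      · simp only [Option.some.injEq, Prod.mk.injEq] at hex
        obtain ⟨rfl, rfl, _⟩ := hex
        rw [P.dest_port hadj.symm] at hpos
        exact hpos.2.2 hwR hport
      · simp only [Option.some.injEq, Prod.mk.injEq] at hex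
        exact h1 (hex.1 ▸ hvvis)
      · simp only [Option.some.injEq, Prod.mk.injEq] at hex
        exact h1 (hex.1 ▸ hvvis)
    | bwd =>
      simp only [PosInv] at hex hpos
      have : x = v := by
        split_ifs at hex <;> simp only [Option.some.injEq, Prod.mk.injEq] at hex <;>
          exact hex.1
      exact hnothead (this ▸ hpos.2)

theorem exists_first_visit {vR w : V} {t : ℕ} (hwR : w ≠ vR) (hw : w ∈ (P.trace vR t).vis) :
    ∃ i q, i + 1 < t ∧ (P.trace vR (i + 1)).pos = PPos.moving w q PDir.fwd ∧
      w ∉ (P.trace vR (i + 1)).vis ∧ w ∈ (P.trace vR (i + 2)).vis ∧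
      (P.trace vR (i + 2)).par w = q := by
  induction t with
  | zero => simp [trace, hwR] at hw
  | succ t ih =>
    by_cases hwt : w ∈ (P.trace vR t).vis
    · obtain ⟨i, q, h1, h2⟩ := ih hwt
      exact ⟨i, q, by omega, h2⟩
    · rcases P.step_vis_par vR (P.trace vR t) with ⟨h, _⟩ | ⟨x, q, hp, hx, hvis, hpar⟩
      · exact absurd (h ▸ hw : w ∈ (P.trace vR t).vis) hwt
      · have hxw : w = x := by
          have hw' : w ∈ insert x (P.trace vR t).vis := hvis ▸ hw
          exact (Finset.mem_insert.1 hw').resolve_right hwt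
        subst hxw
        cases t with
        | zero => simp [trace] at hp
        | succ i =>
          refine ⟨i, q, by omega, hp, hx, hw, ?_⟩
          exact (congrFun hpar w).trans (Function.update_self _ _ _)

/-- The port from the parent `v` to a child `w` is used exactly once before time `τ` if the
child has been visited by then and is either still on the stack or only just entered. -/
theorem existsUnique_exitEvent {vR v w : V} {τ : ℕ} (hwR : w ≠ vR)
    (hw : w ∈ (P.trace vR (τ + 1)).vis)
    (hv : P.dest w ((P.trace vR (τ + 1)).par w) = v)
    (hst : w ∈ (P.trace vR τ).vis → w ∈ P.stack vR τ) :
    ∃ i < τ, ∀ j < τ, (∃ d, P.exitEvent vR (P.trace vR j) = some (v, P.port v w, d)) ↔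
      j = i := by
  obtain ⟨i, q, hi, hpos, hnot, hmem, hq⟩ := P.exists_first_visit hwR hw
  have hpar : ∀ j, i + 2 ≤ j → (P.trace vR j).par w = q := fun j hj =>
    (P.trace_par_eq hj hmem).trans hq
  have hqlt := P.port_lt_of_pos_trace hpos
  rw [hpar _ (by omega)] at hv
  have hadj : P.G.Adj w v := hv ▸ (P.dest_spec hqlt).1
  refine ⟨i, by omega, fun j hj => ⟨?_, ?_⟩⟩
  · rintro ⟨d, hd⟩
    by_cases hwj : w ∈ (P.trace vR j).vis
    · have hij : i + 2 ≤ j := by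
        by_contra hcon
        exact hnot (P.trace_vis_mono vR (by omega : j ≤ i + 1) hwj)
      refine absurd hd (P.exitEvent_ne_of_mem_stack hwR ?_ ?_ ?_)
      · exact P.mem_stack_of_le hj.le hwj (hst (P.trace_vis_mono vR hj.le hwj))
      · rw [hpar j hij]; exact hqlt
      · rw [hpar j hij]; exact hv
    · have hnext : (P.trace vR (j + 1)).pos = _ := P.step_pos_of_exitEvent hd
      rw [P.dest_port hadj.symm] at hnext
      have hwj' : w ∉ (P.trace vR (j + 1)).vis := by
        intro hcon
        rcases P.step_vis_par vR (P.trace vR j) with ⟨h, _⟩ | ⟨x, r, hp, hx, hvis, _⟩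
        · exact hwj (h ▸ hcon)
        · have hcon' : w ∈ insert x (P.trace vR j).vis := hvis ▸ hcon
          have hxw := (Finset.mem_insert.1 hcon').resolve_right hwj
          subst hxw
          unfold exitEvent at hd
          rw [hp] at hd
          simp only [if_neg hx, Option.some.injEq, Prod.mk.injEq] at hd
          exact hadj.ne hd.1
      cases d with
      | bwd =>
        have hi' := (P.stackInv_trace vR (j + 1)).pos
        rw [hnext] at hi'
        exact absurd ((P.stackInv_trace vR (j + 1)).subset w
          (List.mem_of_mem_head? hi'.2)) hwj'
      | fwd =>
        have hwj2 : w ∈ (P.trace vR (j + 2)).vis := by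
          change w ∈ (P.step vR (P.trace vR (j + 1))).vis
          unfold step
          rw [hnext]
          simp only [if_neg hwj']
          exact Finset.mem_insert_self _ _
        have h1 : ¬ i + 2 ≤ j + 1 := fun h => hwj' (P.trace_vis_mono vR h hmem)
        have h2 : ¬ j + 2 ≤ i + 1 := fun h => hnot (P.trace_vis_mono vR h hwj2)
        omega
  · rintro rfl
    refine ⟨PDir.fwd, ?_⟩
    have := P.exists_exitEvent_of_step_pos (vR := vR) (s := P.trace vR j) (fun y r e => by
      by_cases h : (P.trace vR j).pos = PPos.moving y r e
      · exact Or.inr (P.port_lt_of_pos_trace h)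
      · exact Or.inl h) hpos
    rwa [hv] at this

/-- At a positive stopping time the last vertex has just been entered in forward direction. -/
theorem stopTime_succ_spec {vR : V} {k τ : ℕ} (h : P.stopTime vR k = τ + 1) :
    ∃ q, (P.trace vR τ).pos = PPos.moving (P.lastVert vR k) q PDir.fwd ∧
      P.lastVert vR k ∉ (P.trace vR τ).vis ∧
      (P.trace vR (τ + 1)).vis = insert (P.lastVert vR k) (P.trace vR τ).vis ∧
      (P.trace vR (τ + 1)).par (P.lastVert vR k) = q := by
  have hne : {t : ℕ | k ≤ ((P.trace vR t).vis).card}.Nonempty := by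
    by_contra hcon
    rw [Set.not_nonempty_iff_eq_empty] at hcon
    simp [stopTime, hcon] at h
  have hmem : k ≤ ((P.trace vR (τ + 1)).vis).card := h ▸ Nat.sInf_mem hne
  have hnot : ¬ k ≤ ((P.trace vR τ).vis).card := fun hcon => by
    have : P.stopTime vR k ≤ τ := Nat.sInf_le hcon
    omega
  rcases P.step_vis_par vR (P.trace vR τ) with ⟨h1, _⟩ | ⟨x, q, hp, hx, hvis, hpar⟩
  · have h1' : (P.trace vR (τ + 1)).vis = (P.trace vR τ).vis := h1
    exact absurd (h1' ▸ hmem) hnot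
  · have hvis' : (P.trace vR (τ + 1)).vis = insert x (P.trace vR τ).vis := hvis
    have hlast : P.lastVert vR k = x := by
      have hex : ∃ v : V, v ∈ P.visitedBy vR k ∧
          v ∉ (P.trace vR (P.stopTime vR k - 1)).vis := by
        refine ⟨x, ?_, ?_⟩
        · rw [visitedBy, h, hvis']; exact Finset.mem_insert_self _ _
        · rwa [h]
      unfold lastVert
      rw [dif_pos hex]
      obtain ⟨ha, hb⟩ := hex.choose_spec
      generalize hex.choose = y at ha hb ⊢
      rw [visitedBy, h, hvis'] at ha
      rw [h] at hb
      exact (Finset.mem_insert.1 ha).resolve_right hb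
    rw [hlast]
    exact ⟨q, hp, hx, hvis', (congrFun hpar x).trans (Function.update_self _ _ _)⟩

theorem treeRel_adj {vR : V} {k : ℕ} {a b : V} (h : (P.treeRel vR k).Adj a b) :
    (a ∈ P.visitedBy vR k ∧ a ≠ vR ∧ b = P.parentVert vR k a) ∨
      (b ∈ P.visitedBy vR k ∧ b ≠ vR ∧ a = P.parentVert vR k b) :=
  ((SimpleGraph.fromRel_adj _ _ _).1 h).2

theorem treeRel_parent {vR : V} {k : ℕ} (a b : V) (h : (P.treeRel vR k).Adj a b) :
    (a ≠ vR ∧ b = P.parentVert vR k a) ∨ (b ≠ vR ∧ a = P.parentVert vR k b) :=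
  (P.treeRel_adj h).imp And.right And.right

/-- Every vertex of the rootpath other than the last one is on the stack when the traversal
stops. -/
theorem mem_stack_of_onRootpath {vR w : V} {k τ : ℕ} (h : P.stopTime vR k = τ + 1)
    (hw : P.onRootpath vR k w) : w = P.lastVert vR k ∨ w ∈ P.stack vR τ := by
  obtain ⟨q, hp, hx, hvis, hpar⟩ := P.stopTime_succ_spec h
  obtain ⟨p, hpp, hwp⟩ := hw
  have hinv := P.stackInv_trace vR τ
  refine SimpleGraph.Walk.IsPath.support_subset_of_parent_closed P.treeRel_parent
    (A := {a | a = P.lastVert vR k ∨ a ∈ P.stack vR τ}) ?_ p.reverse hpp.reverse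
    (Or.inl rfl) w (by simpa using hwp)
  rintro a (rfl | ha) hne
  · right
    rw [parentVert, parFinal, h, hpar]
    exact List.mem_of_mem_head? (P.head?_stack_of_fwd hp)
  · right
    rw [parentVert, parFinal, h, P.trace_par_eq (Nat.le_succ τ) (hinv.subset a ha)]
    exact hinv.chain.dest_mem a ha hne

end Traversal

end PortedGraph

/-- for every `2 ≤ k ≤ n`, if `v = v_i` (with `i < s`) is a rootpath
vertex other than `v_L` and `w = v_{i+1}` is the next vertex on the rootpath
(characterized as: `w` is on the rootpath, adjacent to `v` in `T`, and `v` lies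
on the unique path in `T` from `v_R` to `w`), then during the `k`-stopped
port-DFS traversal the walk leaves `v` via its child port `port(v, w)` exactly
once. -/
theorem statement6 {V : Type} [Fintype V] [DecidableEq V]
    (P : PortedGraph V) (vR : V) (k : ℕ)
    (hk1 : 2 ≤ k) (hk2 : k ≤ Fintype.card V)
    (v w : V) (hv : P.onRootpath vR k v) (hvL : v ≠ P.lastVert vR k)
    (hw : P.onRootpath vR k w) (hadj : (P.treeRel vR k).Adj v w)
    (hanc : ∀ p : (P.treeRel vR k).Walk vR w, p.IsPath → v ∈ p.support) :
    ((Finset.Icc 1 (P.stopTime vR k - 1)).filter (fun t =>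
      ∃ d : PDir,
        P.exitEvent vR (P.trace vR (t - 1)) = some (v, P.port v w, d))).card
      = 1 := by
  have hadj' : w ∈ P.visitedBy vR k ∧ w ≠ vR ∧ v = P.parentVert vR k w := by
    rcases P.treeRel_adj hadj with ⟨_, hvR, hpar⟩ | h
    · exfalso
      obtain ⟨p, hp, hwp⟩ := hw
      have hq := hp.takeUntil hwp
      have hvq := hanc _ hq
      have hv' : v ∈ (p.takeUntil w hwp).reverse.support := by simpa using hvq
      have hmem := SimpleGraph.Walk.IsPath.parent_mem_support P.treeRel_parent _
        (hq.reverse.dropUntil hv') hvR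
      rw [← hpar] at hmem
      have hnd := hq.reverse.support_nodup
      rw [← SimpleGraph.Walk.take_spec _ hv', SimpleGraph.Walk.support_append] at hnd
      refine (List.nodup_append.1 hnd).2.2 w (SimpleGraph.Walk.start_mem_support _) w ?_ rfl
      rw [← SimpleGraph.Walk.cons_tail_support, List.mem_cons] at hmem
      exact hmem.resolve_left hadj.ne'
    · exact h
  obtain ⟨hwvis, hwR, hvw⟩ := hadj'
  cases hτ : P.stopTime vR k with
  | zero =>
    rw [PortedGraph.visitedBy, hτ] at hwvis
    exact absurd (by simpa [PortedGraph.trace] using hwvis) hwR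
  | succ τ =>
    rw [PortedGraph.visitedBy, hτ] at hwvis
    rw [PortedGraph.parentVert, PortedGraph.parFinal, hτ] at hvw
    obtain ⟨q, _, hlast, _⟩ := P.stopTime_succ_spec hτ
    obtain ⟨i, hi, huniq⟩ := P.existsUnique_exitEvent hwR hwvis hvw.symm fun hwτ =>
      (P.mem_stack_of_onRootpath hτ hw).resolve_left fun h => hlast (h ▸ hwτ)
    rw [Finset.card_eq_one]
    refine ⟨i + 1, ?_⟩
    ext t
    rw [Finset.mem_filter, Finset.mem_Icc, Finset.mem_singleton]
    constructor
    · rintro ⟨⟨h1, h2⟩, h3⟩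
      have := (huniq (t - 1) (by omega)).1 h3
      omega
    · rintro rfl
      exact ⟨by omega, (huniq i hi).2 rfl⟩
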